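/- arXiv:2307.04609 — 2 statements merged into one kernel-verified Lean document; each statement's English description precedes it below -/
import Mathlib

section
/- Let V₁, V₂ be real vector spaces carrying algebraic almost contact structures (φ₁, η₁, ξ₁) and (φ₂, η₂, ξ₂) with compatible metrics g₁, g₂, and let a, b ∈ ℝ with b ≠ 0. Define on V₁ × V₂ the bilinear form g_α((X₁,X₂),(Y₁,Y₂)) := g₁(X₁,Y₁) + g₂(X₂,Y₂) − (a/b²)·(η₁(X₁)·η₂(Y₂) + η₁(Y₁)·η₂(X₂)) + ((a²+b²)/b² − 1)·η₁(X₁)·η₁(Y₁) + (1/b² − 1)·η₂(X₂)·η₂(Y₂), and the endomorphism J(X₁, X₂) := (φ₁(X₁) + (1/b)·(a·η₁(X₁) − η₂(X₂))·ξ₁, φ₂(X₂) + (1/b)·((a²+b²)·η₁(X₁) − a·η₂(X₂))·ξ₂). Then g_α(JX, JY) = g_α(X, Y) for all X, Y ∈ V₁ × V₂. -/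
/-- An algebraic almost contact structure on a real vector space `V`:
a triple `(φ, η, ξ)` with `φ` a linear endomorphism of `V`, `η` a linear
functional on `V`, and `ξ ∈ V`, satisfying `η ∘ φ = 0`,
`φ ∘ φ = −id + (x ↦ η(x)·ξ)`, `η(ξ) = 1`, and `φ(ξ) = 0`. -/
structure AlgAlmostContact (V : Type*) [AddCommGroup V] [Module ℝ V] where
  φ : V →ₗ[ℝ] V
  η : V →ₗ[ℝ] ℝ
  ξ : V
  eta_phi : ∀ x, η (φ x) = 0
  phi_phi : ∀ x, φ (φ x) = -x + η x • ξ
  eta_xi : η ξ = 1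
  phi_xi : φ ξ = 0

/-- A compatible metric for an algebraic almost contact structure `(φ, η, ξ)`:
a symmetric positive-definite bilinear form `g` with `η(x) = g(x, ξ)` and
`g(φx, φy) = g(x,y) − η(x)·η(y)`. -/
structure CompatibleMetric {V : Type*} [AddCommGroup V] [Module ℝ V]
    (S : AlgAlmostContact V) where
  g : V →ₗ[ℝ] V →ₗ[ℝ] ℝ
  symm : ∀ x y, g x y = g y x
  posdef : ∀ x, x ≠ 0 → 0 < g x x
  eta_eq : ∀ x, S.η x = g x S.ξ
  compat : ∀ x y, g (S.φ x) (S.φ y) = g x y - S.η x * S.η y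


/-- A compatible metric pairs `φ x + s • ξ` and `φ y + t • ξ` without cross terms. -/
theorem CompatibleMetric.phi_add_smul_xi {V : Type*} [AddCommGroup V] [Module ℝ V]
    {S : AlgAlmostContact V} (G : CompatibleMetric S) (x y : V) (s t : ℝ) :
    G.g (S.φ x + s • S.ξ) (S.φ y + t • S.ξ) = G.g x y - S.η x * S.η y + s * t := by
  have hξ (z : V) : G.g S.ξ z = S.η z := by rw [G.symm, G.eta_eq]
  simp [hξ, ← G.eta_eq, G.compat, S.eta_phi, S.eta_xi]

/-- The functional `η` reads off the `ξ`-component of `φ x + s • ξ`. -/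
theorem AlgAlmostContact.eta_phi_add_smul_xi {V : Type*} [AddCommGroup V] [Module ℝ V]
    (S : AlgAlmostContact V) (x : V) (s : ℝ) : S.η (S.φ x + s • S.ξ) = s := by
  simp [S.eta_phi, S.eta_xi]

/-- the bilinear form `g_α` on the product of two algebraic
almost contact structures with compatible metrics is Hermitian with respect to
the complex structure `J` induced by the `G_α`-quotient (`a = Re α`, `b = Im α`). -/
theorem Galpha_metric_hermitian {V₁ V₂ : Type*}
    [AddCommGroup V₁] [Module ℝ V₁] [AddCommGroup V₂] [Module ℝ V₂]
    (S₁ : AlgAlmostContact V₁) (S₂ : AlgAlmostContact V₂)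
    (G₁ : CompatibleMetric S₁) (G₂ : CompatibleMetric S₂)
    (a b : ℝ) (hb : b ≠ 0)
    (g : V₁ × V₂ → V₁ × V₂ → ℝ)
    (hg : ∀ (X₁ Y₁ : V₁) (X₂ Y₂ : V₂),
      g (X₁, X₂) (Y₁, Y₂) =
        G₁.g X₁ Y₁ + G₂.g X₂ Y₂
          - (a / b ^ 2) * (S₁.η X₁ * S₂.η Y₂ + S₁.η Y₁ * S₂.η X₂)
          + ((a ^ 2 + b ^ 2) / b ^ 2 - 1) * S₁.η X₁ * S₁.η Y₁
          + (1 / b ^ 2 - 1) * S₂.η X₂ * S₂.η Y₂)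
    (J : (V₁ × V₂) →ₗ[ℝ] (V₁ × V₂))
    (hJ : ∀ (X₁ : V₁) (X₂ : V₂),
      J (X₁, X₂) =
        (S₁.φ X₁ + ((1 / b) * (a * S₁.η X₁ - S₂.η X₂)) • S₁.ξ,
         S₂.φ X₂ + ((1 / b) * ((a ^ 2 + b ^ 2) * S₁.η X₁ - a * S₂.η X₂)) • S₂.ξ)) :
    ∀ X Y : V₁ × V₂, g (J X) (J Y) = g X Y := by
  rintro ⟨X₁, X₂⟩ ⟨Y₁, Y₂⟩
  simp only [hJ, hg, CompatibleMetric.phi_add_smul_xi, AlgAlmostContact.eta_phi_add_smul_xi]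
  field_simp
  ring
end

section
/- Let V₁, V₂ be real vector spaces carrying algebraic almost contact structures (φ₁, η₁, ξ₁) and (φ₂, η₂, ξ₂) with compatible metrics g₁, g₂, and let a, b ∈ ℝ with b ≠ 0. Then the bilinear form on V₁ × V₂ given by g_α((X₁,X₂),(Y₁,Y₂)) := g₁(X₁,Y₁) + g₂(X₂,Y₂) − (a/b²)·(η₁(X₁)·η₂(Y₂) + η₁(Y₁)·η₂(X₂)) + ((a²+b²)/b² − 1)·η₁(X₁)·η₁(Y₁) + (1/b² − 1)·η₂(X₂)·η₂(Y₂) is positive definite. -/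
theorem CompatibleMetric.nonneg {V : Type*} [AddCommGroup V] [Module ℝ V]
    {S : AlgAlmostContact V} (G : CompatibleMetric S) (x : V) : 0 ≤ G.g x x := by
  rcases eq_or_ne x 0 with rfl | hx
  · simp
  · exact (G.posdef x hx).le

theorem CompatibleMetric.eta_sq_le {V : Type*} [AddCommGroup V] [Module ℝ V]
    {S : AlgAlmostContact V} (G : CompatibleMetric S) (x : V) :
    S.η x ^ 2 ≤ G.g x x := by
  have h := G.nonneg (S.φ x)
  rw [G.compat] at h
  linarith [sq (S.η x)]

/-- the bilinear form `g_α` on the product of two algebraic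
almost contact structures with compatible metrics (`a = Re α`, `b = Im α`)
is positive definite. -/
theorem Galpha_metric_posdef {V₁ V₂ : Type*}
    [AddCommGroup V₁] [Module ℝ V₁] [AddCommGroup V₂] [Module ℝ V₂]
    (S₁ : AlgAlmostContact V₁) (S₂ : AlgAlmostContact V₂)
    (G₁ : CompatibleMetric S₁) (G₂ : CompatibleMetric S₂)
    (a b : ℝ) (hb : b ≠ 0)
    (g : V₁ × V₂ → V₁ × V₂ → ℝ)
    (hg : ∀ (X₁ Y₁ : V₁) (X₂ Y₂ : V₂),
      g (X₁, X₂) (Y₁, Y₂) =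
        G₁.g X₁ Y₁ + G₂.g X₂ Y₂
          - (a / b ^ 2) * (S₁.η X₁ * S₂.η Y₂ + S₁.η Y₁ * S₂.η X₂)
          + ((a ^ 2 + b ^ 2) / b ^ 2 - 1) * S₁.η X₁ * S₁.η Y₁
          + (1 / b ^ 2 - 1) * S₂.η X₂ * S₂.η Y₂) :
    ∀ X : V₁ × V₂, X ≠ 0 → 0 < g X X := by
  rintro ⟨X₁, X₂⟩ hX
  have key : g (X₁, X₂) (X₁, X₂) =
      (G₁.g X₁ X₁ - S₁.η X₁ ^ 2) + (G₂.g X₂ X₂ - S₂.η X₂ ^ 2) + S₁.η X₁ ^ 2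
        + ((a * S₁.η X₁ - S₂.η X₂) / b) ^ 2 := by
    rw [hg]
    field_simp
    ring
  have h₁ := G₁.eta_sq_le X₁
  have h₂ := G₂.eta_sq_le X₂
  have hsq := sq_nonneg ((a * S₁.η X₁ - S₂.η X₂) / b)
  rw [key]
  by_cases hu : S₁.η X₁ = 0
  · by_cases hv : S₂.η X₂ = 0
    · have hpos : 0 < G₁.g X₁ X₁ + G₂.g X₂ X₂ := by
        by_cases hX₁ : X₁ = 0
        · have hX₂ : X₂ ≠ 0 := fun h => hX (by simp [hX₁, h])
          linarith [G₁.nonneg X₁, G₂.posdef X₂ hX₂]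
        · linarith [G₁.posdef X₁ hX₁, G₂.nonneg X₂]
      simpa [hu, hv] using hpos
    · have hne : (a * S₁.η X₁ - S₂.η X₂) / b ≠ 0 :=
        div_ne_zero (by simpa [hu] using hv) hb
      linarith [sq_pos_of_ne_zero hne, sq_nonneg (S₁.η X₁)]
  · linarith [sq_pos_of_ne_zero hu]
end
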